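/- Let U ⊆ ℝⁿ be open and let ∇ be a torsion-free affine connection on U with curvature R_{ab}^c_d. A smooth totally antisymmetric 3-tensor field μ_{bcd} on U is a Killing–Yano 3-form, i.e. ∇_a μ_{bcd} + ∇_b μ_{acd} = 0 on U, if and only if there exists a smooth totally antisymmetric 4-tensor field ρ_{bcde} on U such that ∇_a μ_{bcd} = ρ_{abcd} and ∇_a ρ_{bcde} = −4 · Alt_{bcde}[ R_{ab}^f_c μ_{def} ] everywhere on U, where Alt_{bcde} denotes antisymmetrization over the indices b, c, d, e with 1/4! normalization and R_{ab}^f_c μ_{def} denotes the contraction over f. Such ρ is unique, namely ρ_{abcd} = ∇_a μ_{bcd}. -/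

import Mathlib

open scoped BigOperators

noncomputable section

/-- Partial derivative in coordinate direction `a`. -/
def pd {n : ℕ} (a : Fin n) (f : (Fin n → ℝ) → ℝ) (x : Fin n → ℝ) : ℝ :=
  fderiv ℝ f x (Pi.single a 1)

/-- Curvature `R_{ab}ᶜ_d` of the affine connection with Christoffel symbols `Γ`. -/
def curv {n : ℕ} (Γ : Fin n → Fin n → Fin n → (Fin n → ℝ) → ℝ)
    (a b c d : Fin n) (x : Fin n → ℝ) : ℝ :=
  pd a (Γ b d c) x - pd b (Γ a d c) x +
    ∑ e, (Γ b d e x * Γ a e c x - Γ a d e x * Γ b e c x)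

/-- Covariant derivative `∇_a T_{bcd}` of a covariant 3-tensor. -/
def cov3 {n : ℕ} (Γ : Fin n → Fin n → Fin n → (Fin n → ℝ) → ℝ)
    (a : Fin n) (T : Fin n → Fin n → Fin n → (Fin n → ℝ) → ℝ) (b c d : Fin n)
    (x : Fin n → ℝ) : ℝ :=
  pd a (T b c d) x - ∑ e, Γ a b e x * T e c d x - ∑ e, Γ a c e x * T b e d x
    - ∑ e, Γ a d e x * T b c e x

/-- Covariant derivative `∇_a T_{bcde}` of a covariant 4-tensor. -/
def cov4 {n : ℕ} (Γ : Fin n → Fin n → Fin n → (Fin n → ℝ) → ℝ)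
    (a : Fin n) (T : Fin n → Fin n → Fin n → Fin n → (Fin n → ℝ) → ℝ)
    (b c d e : Fin n) (x : Fin n → ℝ) : ℝ :=
  pd a (T b c d e) x - ∑ f, Γ a b f x * T f c d e x - ∑ f, Γ a c f x * T b f d e x
    - ∑ f, Γ a d f x * T b c f e x - ∑ f, Γ a e f x * T b c d f x

/-- Antisymmetrization (with `1/4!` normalization) of a 4-index expression over
its four indices. -/
def alt4 {n : ℕ} (T : Fin n → Fin n → Fin n → Fin n → ℝ) (b c d e : Fin n) : ℝ :=
  (1/24 : ℝ) * ∑ π : Equiv.Perm (Fin 4),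
    ((Equiv.Perm.sign π : ℤ) : ℝ) *
      T (![b, c, d, e] (π 0)) (![b, c, d, e] (π 1)) (![b, c, d, e] (π 2))
        (![b, c, d, e] (π 3))

open scoped ContDiff

section Algebra

/-- Solving `X_{a|bcde} - X_{b|acde} = -K_{ab|cde}` for `X` alternating in its last four indices,
where `K` is built cyclically from an `S` with the symmetries of `R_{ab}ᶠ_c μ_{def}`. -/
theorem three_mul_eq_of_sub_swap {ι : Type*} {X S : ι → ι → ι → ι → ι → ℝ}
    (hX₁ : ∀ a b c d e, X a b c d e = -X a c b d e)
    (hX₂ : ∀ a b c d e, X a b c d e = -X a b d c e)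
    (hX₃ : ∀ a b c d e, X a b c d e = -X a b c e d)
    (hS₁ : ∀ a b c d e, S a b c d e = -S b a c d e)
    (hS₂ : ∀ a b c d e, S a b c d e = -S a b c e d)
    (hS₃ : ∀ a b c d e, S a b c d e + S b c a d e + S c a b d e = 0)
    (hXS : ∀ a b c d e, X a b c d e - X b a c d e =
      -(S a b c d e + S a b d e c + S a b e c d)) (a b c d e : ι) :
    3 * X a b c d e =
      -(S a b c d e + S a b d e c + S a b e c d)
      + (S a c b d e + S a c d e b + S a c e b d)
      - (S a d b c e + S a d c e b + S a d e b c)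
      + (S a e b c d + S a e c d b + S a e d b c) := by
  have Xc (p q r s t) : X p q r s t = -X p r q s t ∧ X p q r s t = X p s q r t ∧
      X p q r s t = -X p t q r s := by
    grind
  grind

set_option maxHeartbeats 1000000 in
theorem alt4_eq_of_antisymm {n : ℕ} {T : Fin n → Fin n → Fin n → Fin n → ℝ}
    (hT : ∀ b c d e, T b c d e = -T b c e d) (b c d e : Fin n) :
    alt4 T b c d e = 1 / 12 * (
      (T b c d e + T b d e c + T b e c d)
      - (T c b d e + T c d e b + T c e b d)
      + (T d b c e + T d c e b + T d e b c)
      - (T e b c d + T e c d b + T e d b c)) := by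
  unfold alt4
  have h₂ {m : ℕ} (p : Fin (m + 3)) (σ : Equiv.Perm (Fin (m + 2))) :
      Equiv.Perm.decomposeFin.symm (p, σ) 2 = Equiv.swap 0 p (σ 1).succ :=
    Equiv.Perm.decomposeFin_symm_apply_succ σ p 1
  have h₃ (p : Fin 4) (σ : Equiv.Perm (Fin 3)) :
      Equiv.Perm.decomposeFin.symm (p, σ) 3 = Equiv.swap 0 p (σ 2).succ :=
    Equiv.Perm.decomposeFin_symm_apply_succ σ p 2
  simp only [← Fintype.sum_equiv Equiv.Perm.decomposeFin.symm _ _ (fun _ => rfl),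
    Fintype.sum_prod_type, Fin.sum_univ_succ]
  simp [Equiv.Perm.decomposeFin.symm_sign, Fin.ext_iff, h₂, h₃, Equiv.swap_apply_def]
  linear_combination (-1 / 24) * (hT b c d e + hT b d e c + hT b e c d
    - hT c b d e - hT c d e b - hT c e b d + hT d b c e + hT d c e b + hT d e b c
    - hT e b c d - hT e c d b - hT e d b c)

end Algebra

section PartialDerivatives

variable {n : ℕ} {U : Set (Fin n → ℝ)} {f g : (Fin n → ℝ) → ℝ} {x : Fin n → ℝ}

theorem pd_congr (hU : IsOpen U) (h : Set.EqOn f g U) (hx : x ∈ U) (a : Fin n) :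
    pd a f x = pd a g x := by
  rw [pd, pd, (h.eventuallyEq_of_mem (hU.mem_nhds hx)).fderiv_eq]

theorem pd_neg (a : Fin n) : pd a (fun y => -f y) x = -pd a f x := by
  simp [pd]

theorem pd_sub (a : Fin n) (hf : DifferentiableAt ℝ f x) (hg : DifferentiableAt ℝ g x) :
    pd a (fun y => f y - g y) x = pd a f x - pd a g x := by
  simp [pd, fderiv_fun_sub hf hg]

theorem pd_sum_mul {F G : Fin n → (Fin n → ℝ) → ℝ} (a : Fin n)
    (hF : ∀ i, DifferentiableAt ℝ (F i) x) (hG : ∀ i, DifferentiableAt ℝ (G i) x) :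
    pd a (fun y => ∑ i, F i y * G i y) x =
      ∑ i, pd a (F i) x * G i x + ∑ i, F i x * pd a (G i) x := by
  simp only [pd]
  rw [fderiv_fun_sum (A := fun i y => F i y * G i y) fun i _ => (hF i).fun_mul (hG i),
    _root_.sum_apply, ← Finset.sum_add_distrib]
  refine Finset.sum_congr rfl fun i _ => ?_
  rw [fderiv_fun_mul (hF i) (hG i)]
  simp
  ring

theorem contDiffOn_pd (hU : IsOpen U) (hf : ContDiffOn ℝ ∞ f U) (a : Fin n) :
    ContDiffOn ℝ ∞ (pd a f) U :=
  (hf.fderiv_of_isOpen hU (m := ∞) le_rfl).clm_apply contDiffOn_const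

theorem pd_comm (hU : IsOpen U) (hf : ContDiffOn ℝ ∞ f U) (hx : x ∈ U) (a b : Fin n) :
    pd a (pd b f) x = pd b (pd a f) x := by
  have hfx : ContDiffAt ℝ ∞ f x := hf.contDiffAt (hU.mem_nhds hx)
  have hd : DifferentiableAt ℝ (fderiv ℝ f) x :=
    (hfx.fderiv_right (m := 1) (by norm_cast)).differentiableAt one_ne_zero
  have key (a b : Fin n) : pd a (pd b f) x =
      fderiv ℝ (fderiv ℝ f) x (Pi.single a 1) (Pi.single b 1) := by
    change fderiv ℝ (fun y => fderiv ℝ f y (Pi.single b 1)) x _ = _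
    rw [fderiv_clm_apply hd (differentiableAt_const _)]
    simp
  rw [key, key]
  exact hfx.isSymmSndFDerivAt (by simp; norm_cast) _ _

end PartialDerivatives

section SlotActions

variable {n : ℕ}

/-- The action of a matrix on the first slot of a covariant 3-tensor. -/
def actFst (A : Fin n → Fin n → ℝ) (T : Fin n → Fin n → Fin n → ℝ) (c d e : Fin n) : ℝ :=
  ∑ f, A c f * T f d e

/-- The action of a matrix on the second slot of a covariant 3-tensor. -/
def actSnd (A : Fin n → Fin n → ℝ) (T : Fin n → Fin n → Fin n → ℝ) (c d e : Fin n) : ℝ :=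
  ∑ f, A d f * T c f e

/-- The action of a matrix on the third slot of a covariant 3-tensor. -/
def actTrd (A : Fin n → Fin n → ℝ) (T : Fin n → Fin n → Fin n → ℝ) (c d e : Fin n) : ℝ :=
  ∑ f, A e f * T c d f

/-- The derivation action of a matrix on covariant 3-tensors. -/
def act (A : Fin n → Fin n → ℝ) (T : Fin n → Fin n → Fin n → ℝ) (c d e : Fin n) : ℝ :=
  actFst A T c d e + actSnd A T c d e + actTrd A T c d e

/-- The derivation action is an anti-homomorphism of Lie algebras. -/
theorem act_act_sub_act_act (A B : Fin n → Fin n → ℝ) (T : Fin n → Fin n → Fin n → ℝ)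
    (c d e : Fin n) :
    act A (act B T) c d e - act B (act A T) c d e =
      act (fun c f => ∑ g, (A c g * B g f - B c g * A g f)) T c d e := by
  have comm (p q : Fin n → ℝ) (M : Fin n → Fin n → ℝ) :
      ∑ f, p f * ∑ g, q g * M f g = ∑ g, q g * ∑ f, p f * M f g := by
    simp only [Finset.mul_sum]
    rw [Finset.sum_comm]
    exact Finset.sum_congr rfl fun _ _ => Finset.sum_congr rfl fun _ _ => by ring
  have comp (p q : Fin n → ℝ) (A B : Fin n → Fin n → ℝ) (v : Fin n → ℝ) :
      ∑ f, (∑ g, (p g * B g f - q g * A g f)) * v f =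
        ∑ g, p g * ∑ f, B g f * v f - ∑ g, q g * ∑ f, A g f * v f := by
    simp only [Finset.sum_mul, Finset.mul_sum]
    rw [Finset.sum_comm, ← Finset.sum_sub_distrib]
    refine Finset.sum_congr rfl fun _ _ => ?_
    rw [← Finset.sum_sub_distrib]
    exact Finset.sum_congr rfl fun _ _ => by ring
  simp only [act, actFst, actSnd, actTrd, comp, mul_add, Finset.sum_add_distrib]
  rw [comm (A c) (B d) (fun f g => T f g e), comm (A c) (B e) (fun f g => T f d g),
    comm (A d) (B c) (fun f g => T g f e), comm (A d) (B e) (fun f g => T c f g),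
    comm (A e) (B c) (fun f g => T g d f), comm (A e) (B d) (fun f g => T c g f)]
  ring

end SlotActions

section CovariantDerivatives

variable {n : ℕ} {U : Set (Fin n → ℝ)} {Γ : Fin n → Fin n → Fin n → (Fin n → ℝ) → ℝ}
  {μ : Fin n → Fin n → Fin n → (Fin n → ℝ) → ℝ}
  {ρ : Fin n → Fin n → Fin n → Fin n → (Fin n → ℝ) → ℝ} {x : Fin n → ℝ}

theorem contDiffOn_cov3 (hU : IsOpen U) (hΓ : ∀ a b c, ContDiffOn ℝ ∞ (Γ a b c) U)
    (hμ : ∀ b c d, ContDiffOn ℝ ∞ (μ b c d) U) (a b c d : Fin n) :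
    ContDiffOn ℝ ∞ (cov3 Γ a μ b c d) U :=
  (((contDiffOn_pd hU (hμ b c d) a).sub
    (ContDiffOn.sum fun f _ => (hΓ a b f).mul (hμ f c d))).sub
    (ContDiffOn.sum fun f _ => (hΓ a c f).mul (hμ b f d))).sub
    (ContDiffOn.sum fun f _ => (hΓ a d f).mul (hμ b c f))

theorem curv_swap (a b c d : Fin n) : curv Γ a b c d x = -curv Γ b a c d x := by
  have h : ∑ e, (Γ b d e x * Γ a e c x - Γ a d e x * Γ b e c x) =
      -∑ e, (Γ a d e x * Γ b e c x - Γ b d e x * Γ a e c x) := by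
    rw [← Finset.sum_neg_distrib]
    exact Finset.sum_congr rfl fun _ _ => by ring
  rw [curv, curv, h]
  ring

/-- The first Bianchi identity. -/
theorem curv_bianchi (hU : IsOpen U) (hΓ : ∀ a b c, ∀ x ∈ U, Γ a b c x = Γ b a c x)
    (hx : x ∈ U) (a b c d : Fin n) :
    curv Γ a b d c x + curv Γ b c d a x + curv Γ c a d b x = 0 := by
  have hpd (a b c d : Fin n) : pd a (Γ b c d) x = pd a (Γ c b d) x :=
    pd_congr hU (hΓ b c d) hx a
  simp only [curv, Finset.sum_sub_distrib]
  rw [hpd a b c d, hpd b c a d, hpd c a b d]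
  simp only [hΓ b a _ x hx, hΓ c a _ x hx, hΓ c b _ x hx]
  ring

/-- The Ricci identity for covariant 3-tensors. -/
theorem cov4_cov3_sub (hU : IsOpen U) (hΓ : ∀ a b c, ContDiffOn ℝ ∞ (Γ a b c) U)
    (hΓsym : ∀ a b c, ∀ x ∈ U, Γ a b c x = Γ b a c x)
    (hμ : ∀ b c d, ContDiffOn ℝ ∞ (μ b c d) U) (hx : x ∈ U) (a b c d e : Fin n) :
    cov4 Γ a (fun p => cov3 Γ p μ) b c d e x - cov4 Γ b (fun p => cov3 Γ p μ) a c d e x =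
      -act (fun p f => curv Γ a b f p x) (fun p q r => μ p q r x) c d e := by
  have hdiff {f : (Fin n → ℝ) → ℝ} (hf : ContDiffOn ℝ ∞ f U) : DifferentiableAt ℝ f x :=
    (hf.differentiableOn (by simp)).differentiableAt (hU.mem_nhds hx)
  have hsum {F G : Fin n → (Fin n → ℝ) → ℝ} (hF : ∀ i, ContDiffOn ℝ ∞ (F i) U)
      (hG : ∀ i, ContDiffOn ℝ ∞ (G i) U) : ContDiffOn ℝ ∞ (fun y => ∑ i, F i y * G i y) U :=
    ContDiffOn.sum fun i _ => (hF i).mul (hG i)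
  let m (p q r : Fin n) : ℝ := μ p q r x
  let dm (a p q r : Fin n) : ℝ := pd a (μ p q r) x
  let G (a p f : Fin n) : ℝ := Γ a p f x
  let dG (a b p f : Fin n) : ℝ := pd a (Γ b p f) x
  have hpd (a b : Fin n) : pd a (cov3 Γ b μ c d e) x =
      pd a (pd b (μ c d e)) x - act (dG a b) m c d e - act (G b) (dm a) c d e := by
    change pd a (fun y => pd b (μ c d e) y - ∑ f, Γ b c f y * μ f d e y
      - ∑ f, Γ b d f y * μ c f e y - ∑ f, Γ b e f y * μ c d f y) x = _
    have h₀ := contDiffOn_pd hU (hμ c d e) b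
    have h₁ := hsum (fun f => hΓ b c f) (fun f => hμ f d e)
    have h₂ := hsum (fun f => hΓ b d f) (fun f => hμ c f e)
    have h₃ := hsum (fun f => hΓ b e f) (fun f => hμ c d f)
    rw [pd_sub a (hdiff ((h₀.sub h₁).sub h₂)) (hdiff h₃),
      pd_sub a (hdiff (h₀.sub h₁)) (hdiff h₂), pd_sub a (hdiff h₀) (hdiff h₁),
      pd_sum_mul a (fun f => hdiff (hΓ b c f)) (fun f => hdiff (hμ f d e)),
      pd_sum_mul a (fun f => hdiff (hΓ b d f)) (fun f => hdiff (hμ c f e)),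
      pd_sum_mul a (fun f => hdiff (hΓ b e f)) (fun f => hdiff (hμ c d f))]
    simp only [act, actFst, actSnd, actTrd, m, dm, G, dG]
    ring
  have hcov (b p q r : Fin n) : cov3 Γ b μ p q r x = dm b p q r - act (G b) m p q r := by
    simp only [cov3, act, actFst, actSnd, actTrd, m, dm, G]
    ring
  have hact (A : Fin n → Fin n → ℝ) (T T' : Fin n → Fin n → Fin n → ℝ) :
      act A (fun p q r => T p q r - T' p q r) c d e = act A T c d e - act A T' c d e := by
    simp only [act, actFst, actSnd, actTrd, mul_sub, Finset.sum_sub_distrib]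
    ring
  have hcov4 (a b : Fin n) : cov4 Γ a (fun p => cov3 Γ p μ) b c d e x =
      pd a (pd b (μ c d e)) x - act (dG a b) m c d e - act (G b) (dm a) c d e
        - ∑ f, G a b f * cov3 Γ f μ c d e x
        - (act (G a) (dm b) c d e - act (G a) (act (G b) m) c d e) := by
    have h : (fun p q r => dm b p q r - act (G b) m p q r) = fun p q r => cov3 Γ b μ p q r x := by
      simp only [hcov]
    rw [← hpd, ← hact, h]
    simp only [cov4, act, actFst, actSnd, actTrd, G]
    ring
  have hcurv : act (fun p f => curv Γ a b f p x) m c d e =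
      act (dG a b) m c d e - act (dG b a) m c d e +
        act (fun c f => ∑ g, (G b c g * G a g f - G a c g * G b g f)) m c d e := by
    simp only [curv, act, actFst, actSnd, actTrd, add_mul, sub_mul, Finset.sum_add_distrib,
      Finset.sum_sub_distrib, G, dG]
    ring
  rw [hcov4, hcov4, pd_comm hU (hμ c d e) hx b a, hcurv, ← act_act_sub_act_act]
  simp only [G, hΓsym b a _ x hx]
  ring

theorem cov3_swap₁₂ (hU : IsOpen U) (h : ∀ b c d, ∀ x ∈ U, μ b c d x = -μ c b d x)
    (hx : x ∈ U) (a b c d : Fin n) : cov3 Γ a μ b c d x = -cov3 Γ a μ c b d x := by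
  have hpd : pd a (μ b c d) x = -pd a (μ c b d) x :=
    (pd_congr hU (h b c d) hx a).trans (pd_neg a)
  simp only [cov3, hpd, fun f => h f c d x hx, fun f => h b f d x hx, fun f => h b c f x hx,
    mul_neg, Finset.sum_neg_distrib]
  ring

theorem cov3_swap₂₃ (hU : IsOpen U) (h : ∀ b c d, ∀ x ∈ U, μ b c d x = -μ b d c x)
    (hx : x ∈ U) (a b c d : Fin n) : cov3 Γ a μ b c d x = -cov3 Γ a μ b d c x := by
  have hpd : pd a (μ b c d) x = -pd a (μ b d c) x :=
    (pd_congr hU (h b c d) hx a).trans (pd_neg a)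
  simp only [cov3, hpd, fun f => h f c d x hx, fun f => h b f d x hx, fun f => h b c f x hx,
    mul_neg, Finset.sum_neg_distrib]
  ring

theorem cov4_swap₁₂ (hU : IsOpen U) (h : ∀ b c d e, ∀ x ∈ U, ρ b c d e x = -ρ c b d e x)
    (hx : x ∈ U) (a b c d e : Fin n) : cov4 Γ a ρ b c d e x = -cov4 Γ a ρ c b d e x := by
  have hpd : pd a (ρ b c d e) x = -pd a (ρ c b d e) x :=
    (pd_congr hU (h b c d e) hx a).trans (pd_neg a)
  simp only [cov4, hpd, fun f => h f c d e x hx, fun f => h b f d e x hx,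
    fun f => h b c f e x hx, fun f => h b c d f x hx, mul_neg, Finset.sum_neg_distrib]
  ring

theorem cov4_swap₂₃ (hU : IsOpen U) (h : ∀ b c d e, ∀ x ∈ U, ρ b c d e x = -ρ b d c e x)
    (hx : x ∈ U) (a b c d e : Fin n) : cov4 Γ a ρ b c d e x = -cov4 Γ a ρ b d c e x := by
  have hpd : pd a (ρ b c d e) x = -pd a (ρ b d c e) x :=
    (pd_congr hU (h b c d e) hx a).trans (pd_neg a)
  simp only [cov4, hpd, fun f => h f c d e x hx, fun f => h b f d e x hx,
    fun f => h b c f e x hx, fun f => h b c d f x hx, mul_neg, Finset.sum_neg_distrib]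
  ring

theorem cov4_swap₃₄ (hU : IsOpen U) (h : ∀ b c d e, ∀ x ∈ U, ρ b c d e x = -ρ b c e d x)
    (hx : x ∈ U) (a b c d e : Fin n) : cov4 Γ a ρ b c d e x = -cov4 Γ a ρ b c e d x := by
  have hpd : pd a (ρ b c d e) x = -pd a (ρ b c e d) x :=
    (pd_congr hU (h b c d e) hx a).trans (pd_neg a)
  simp only [cov4, hpd, fun f => h f c d e x hx, fun f => h b f d e x hx,
    fun f => h b c f e x hx, fun f => h b c d f x hx, mul_neg, Finset.sum_neg_distrib]
  ring

/-- The covariant derivative of `∇μ` for a Killing–Yano 3-form `μ`. -/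
theorem cov4_cov3_of_killingYano (hU : IsOpen U) (hΓ : ∀ a b c, ContDiffOn ℝ ∞ (Γ a b c) U)
    (hΓsym : ∀ a b c, ∀ x ∈ U, Γ a b c x = Γ b a c x)
    (hμ : ∀ b c d, ContDiffOn ℝ ∞ (μ b c d) U)
    (hμalt₁ : ∀ b c d, ∀ x ∈ U, μ b c d x = -μ c b d x)
    (hμalt₂ : ∀ b c d, ∀ x ∈ U, μ b c d x = -μ b d c x)
    (hKY : ∀ a b c d, ∀ x ∈ U, cov3 Γ a μ b c d x = -cov3 Γ b μ a c d x)
    (hx : x ∈ U) (a b c d e : Fin n) :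
    cov4 Γ a (fun p => cov3 Γ p μ) b c d e x =
      -4 * alt4 (fun b' c' d' e' => ∑ f, curv Γ a b' f c' x * μ d' e' f x) b c d e := by
  let S (a b c d e : Fin n) : ℝ := ∑ f, curv Γ a b f c x * μ d e f x
  have hS₁ (a b c d e) : S a b c d e = -S b a c d e := by
    simp only [S, fun f => curv_swap (Γ := Γ) (x := x) a b f c, neg_mul, Finset.sum_neg_distrib]
  have hS₂ (a b c d e) : S a b c d e = -S a b c e d := by
    simp only [S, fun f => hμalt₁ d e f x hx, mul_neg, Finset.sum_neg_distrib]
  have hS₃ (a b c d e) : S a b c d e + S b c a d e + S c a b d e = 0 := by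
    simp only [S, ← Finset.sum_add_distrib, ← add_mul, curv_bianchi hU hΓsym hx, zero_mul,
      Finset.sum_const_zero]
  have hRicci (a b c d e : Fin n) : cov4 Γ a (fun p => cov3 Γ p μ) b c d e x -
      cov4 Γ b (fun p => cov3 Γ p μ) a c d e x =
      -(S a b c d e + S a b d e c + S a b e c d) := by
    have h₁ (f : Fin n) : μ f d e x = μ d e f x := by
      rw [hμalt₁ f d e x hx, hμalt₂ d f e x hx, neg_neg]
    have h₂ (f : Fin n) : μ c f e x = μ e c f x := by
      rw [hμalt₂ c f e x hx, hμalt₁ c e f x hx, neg_neg]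
    rw [cov4_cov3_sub hU hΓ hΓsym hμ hx]
    simp only [act, actFst, actSnd, actTrd, S, h₁, h₂]
  have key := three_mul_eq_of_sub_swap
    (X := fun a b c d e => cov4 Γ a (fun p => cov3 Γ p μ) b c d e x) (S := S)
    (cov4_swap₁₂ hU hKY hx)
    (cov4_swap₂₃ hU (fun p _ _ _ _ hy => cov3_swap₁₂ hU hμalt₁ hy p _ _ _) hx)
    (cov4_swap₃₄ hU (fun p _ _ _ _ hy => cov3_swap₂₃ hU hμalt₂ hy p _ _ _) hx)
    hS₁ hS₂ hS₃ hRicci a b c d e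
  rw [alt4_eq_of_antisymm (hS₂ a)]
  linear_combination key / 3

end CovariantDerivatives

/-- **Prolongation of Killing–Yano 3-forms.**
A smooth totally antisymmetric 3-tensor `μ` is a Killing–Yano 3-form,
`∇_a μ_{bcd} + ∇_b μ_{acd} = 0`, iff there is a (unique) smooth totally
antisymmetric 4-tensor `ρ` with `∇_a μ_{bcd} = ρ_{abcd}` and
`∇_a ρ_{bcde} = −4·Alt_{bcde}[R_{ab}ᶠ_c μ_{def}]`; the unique such `ρ` is `∇_a μ_{bcd}`. -/
theorem killing_yano_three_forms_prolongation
    {n : ℕ} (hn : 1 ≤ n) (U : Set (Fin n → ℝ)) (hU : IsOpen U)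
    (Γ : Fin n → Fin n → Fin n → (Fin n → ℝ) → ℝ)
    (hΓsmooth : ∀ a b c, ContDiffOn ℝ (⊤ : ℕ∞) (Γ a b c) U)
    (hΓsym : ∀ a b c, ∀ x ∈ U, Γ a b c x = Γ b a c x)
    (μ : Fin n → Fin n → Fin n → (Fin n → ℝ) → ℝ)
    (hμsmooth : ∀ b c d, ContDiffOn ℝ (⊤ : ℕ∞) (μ b c d) U)
    (hμalt₁ : ∀ b c d, ∀ x ∈ U, μ b c d x = - μ c b d x)
    (hμalt₂ : ∀ b c d, ∀ x ∈ U, μ b c d x = - μ b d c x) :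
    ((∀ a b c d, ∀ x ∈ U, cov3 Γ a μ b c d x + cov3 Γ b μ a c d x = 0) ↔
      ∃ ρ : Fin n → Fin n → Fin n → Fin n → (Fin n → ℝ) → ℝ,
        (∀ b c d e, ContDiffOn ℝ (⊤ : ℕ∞) (ρ b c d e) U) ∧
        (∀ b c d e, ∀ x ∈ U, ρ b c d e x = - ρ c b d e x) ∧
        (∀ b c d e, ∀ x ∈ U, ρ b c d e x = - ρ b d c e x) ∧
        (∀ b c d e, ∀ x ∈ U, ρ b c d e x = - ρ b c e d x) ∧
        (∀ a b c d, ∀ x ∈ U, cov3 Γ a μ b c d x = ρ a b c d x) ∧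
        (∀ a b c d e, ∀ x ∈ U,
          cov4 Γ a ρ b c d e x =
            -4 * alt4 (fun b' c' d' e' => ∑ f, curv Γ a b' f c' x * μ d' e' f x)
              b c d e)) ∧
    (∀ ρ : Fin n → Fin n → Fin n → Fin n → (Fin n → ℝ) → ℝ,
        (∀ b c d e, ContDiffOn ℝ (⊤ : ℕ∞) (ρ b c d e) U) →
        (∀ b c d e, ∀ x ∈ U, ρ b c d e x = - ρ c b d e x) →
        (∀ b c d e, ∀ x ∈ U, ρ b c d e x = - ρ b d c e x) →
        (∀ b c d e, ∀ x ∈ U, ρ b c d e x = - ρ b c e d x) →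
        (∀ a b c d, ∀ x ∈ U, cov3 Γ a μ b c d x = ρ a b c d x) →
        (∀ a b c d e, ∀ x ∈ U,
          cov4 Γ a ρ b c d e x =
            -4 * alt4 (fun b' c' d' e' => ∑ f, curv Γ a b' f c' x * μ d' e' f x)
              b c d e) →
        ∀ a b c d, ∀ x ∈ U, ρ a b c d x = cov3 Γ a μ b c d x) := by
  refine ⟨⟨fun h => ?_, ?_⟩, fun ρ _ _ _ _ h _ a b c d x hx => (h a b c d x hx).symm⟩
  · have hKY (a b c d) (x) (hx : x ∈ U) : cov3 Γ a μ b c d x = -cov3 Γ b μ a c d x :=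
      eq_neg_of_add_eq_zero_left (h a b c d x hx)
    exact ⟨fun p => cov3 Γ p μ, contDiffOn_cov3 hU hΓsmooth hμsmooth, hKY,
      fun b _ _ _ _ hx => cov3_swap₁₂ hU hμalt₁ hx b _ _ _,
      fun b _ _ _ _ hx => cov3_swap₂₃ hU hμalt₂ hx b _ _ _, fun _ _ _ _ _ _ => rfl,
      fun a b c d e x hx => cov4_cov3_of_killingYano hU hΓsmooth hΓsym hμsmooth hμalt₁ hμalt₂
        hKY hx a b c d e⟩
  · rintro ⟨ρ, -, hρ, -, -, hcov, -⟩ a b c d x hx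
    rw [hcov a b c d x hx, hcov b a c d x hx, hρ a b c d x hx, neg_add_cancel]

end
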